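/- Let s, t : ℕ → ℕ be functions with s(n), t(n) ≥ 1 for all n and s(n) + t(n) = o(log log n), i.e. (s(n) + t(n)) / (log log n) → 0 as n → ∞. Then for every ε > 0 there exists n_0 such that for all integers n ≥ n_0, R(SD_{s(n),t(n)}, Q_n) ≤ n + (2 + ε)·(n / log n). -/

import Mathlib

open Finset

/-- The poset Ramsey number `R(P,Q)`: the least `N` such that every blue/red coloring of the
Boolean lattice `Q_N` (subsets of `Fin N` ordered by inclusion, colors as `Bool` with
`true` = blue, `false` = red) contains a blue induced copy of `P` or a red induced copy of `Q`,
where an induced copy is the image of an order embedding. -/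
noncomputable def posetRamsey (P : Type*) (Q : Type*) [PartialOrder P] [PartialOrder Q] : ℕ :=
  sInf {N : ℕ | ∀ c : Finset (Fin N) → Bool,
    (∃ e : P ↪o Finset (Fin N), ∀ p, c (e p) = true) ∨
    (∃ e : Q ↪o Finset (Fin N), ∀ q, c (e q) = false)}

/-- Along a chain `Y 0 ≤ Y 1 ≤ ⋯` in the second factor, either the product order contains a red
copy of the first factor, or there is a blue chain projecting onto `Y 0, …, Y k`. -/
lemma exists_red_embedding_or_blue_chain {α β : Type*} [PartialOrder α] [OrderTop α]
    [PartialOrder β] (c : α × β → Bool) (k : ℕ) (Y : ℕ → β) (hY : Monotone Y) :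
    (∃ e : α ↪o α × β, ∀ a, c (e a) = false) ∨
      ∃ X : ℕ → α, Monotone X ∧ ∀ i ≤ k, c (X i, Y i) = true := by
  let good : α → ℕ → Prop := fun A i =>
    ∃ X : ℕ → α, Monotone X ∧ (∀ j, X j ≤ A) ∧ ∀ j < i, c (X j, Y j) = true
  by_cases htop : good ⊤ (k + 1)
  · obtain ⟨X, hX, -, hc⟩ := htop
    exact Or.inr ⟨X, hX, fun i hi => hc i (by omega)⟩
  left
  have good_mono : ∀ {A B : α} {i : ℕ}, A ≤ B → good A i → good B i :=
    fun hAB ⟨X, hX, hXA, hc⟩ => ⟨X, hX, fun j => (hXA j).trans hAB, hc⟩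
  have hex : ∀ A, ∃ i, ¬ good A (i + 1) := fun A => ⟨k, fun h => htop (good_mono le_top h)⟩
  classical
  let f : α → ℕ := fun A => Nat.find (hex A)
  have hf : ∀ A, good A (f A) := by
    intro A
    rcases Nat.eq_zero_or_pos (f A) with h | h
    · rw [h]
      exact ⟨fun _ => A, monotone_const, fun _ => le_rfl, fun j hj => absurd hj (by omega)⟩
    · have := Nat.find_min (hex A) (m := f A - 1) (by change f A - 1 < f A; omega)
      rw [not_not, Nat.sub_add_cancel h] at this
      exact this
  have f_mono : Monotone f := fun A B hAB =>
    Nat.find_min' (hex A) fun h => Nat.find_spec (hex B) (good_mono hAB h)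
  have hred : ∀ A, c (A, Y (f A)) = false := by
    intro A
    by_contra hblue
    rw [Bool.not_eq_false] at hblue
    obtain ⟨X, hX, hXA, hc⟩ := hf A
    refine Nat.find_spec (hex A) ⟨fun j => if j < f A then X j else A, ?_, ?_, ?_⟩
    · intro i j hij
      dsimp only
      split_ifs with h1 h2 h2
      · exact hX hij
      · exact hXA i
      · omega
      · exact le_rfl
    · intro j
      dsimp only
      split_ifs
      · exact hXA j
      · exact le_rfl
    · intro j hj
      change j < f A + 1 at hj
      dsimp only
      split_ifs with h1
      · exact hc j h1
      · obtain rfl : j = f A := by omega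
        exact hblue
  exact ⟨OrderEmbedding.ofMapLEIff (fun A => (A, Y (f A))) fun A B =>
    ⟨fun h => h.1, fun h => ⟨h, hY (f_mono h)⟩⟩, hred⟩

/-- Two parallel chains with common lower and upper bounds form a copy of a subdivided diamond. -/
lemma exists_subdividedDiamond_embedding {R : Type*} [PartialOrder R] {s t : ℕ} {lo hi : R}
    {u : Fin s → R} {v : Fin t → R} (hu : StrictMono u) (hv : StrictMono v) (hlohi : lo < hi)
    (hlou : ∀ i, lo < u i) (hlov : ∀ j, lo < v j) (huhi : ∀ i, u i < hi) (hvhi : ∀ j, v j < hi)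
    (huv : ∀ i j, ¬ u i ≤ v j) (hvu : ∀ i j, ¬ v j ≤ u i) :
    ∃ e : WithBot (WithTop (Fin s ⊕ Fin t)) ↪o R,
      ∀ p, e p = lo ∨ e p = hi ∨ (∃ i, e p = u i) ∨ ∃ j, e p = v j := by
  let g : WithBot (WithTop (Fin s ⊕ Fin t)) → R := fun p =>
    WithBot.recBotCoe lo (fun q => WithTop.recTopCoe hi (Sum.elim u v) q) p
  refine ⟨OrderEmbedding.ofMapLEIff g ?_, ?_⟩
  · intro a b
    induction a using WithBot.recBotCoe with
    | bot =>
      refine iff_of_true ?_ bot_le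
      induction b using WithBot.recBotCoe with
      | bot => exact le_rfl
      | coe b =>
        induction b using WithTop.recTopCoe with
        | top => exact hlohi.le
        | coe b => rcases b with i | j
                   · exact (hlou i).le
                   · exact (hlov j).le
    | coe a =>
      induction b using WithBot.recBotCoe with
      | bot =>
        refine iff_of_false ?_ (by simp)
        induction a using WithTop.recTopCoe with
        | top => exact hlohi.not_ge
        | coe a => rcases a with i | j
                   · exact (hlou i).not_ge
                   · exact (hlov j).not_ge
      | coe b =>
        rw [WithBot.coe_le_coe]
        induction b using WithTop.recTopCoe with
        | top =>
          refine iff_of_true ?_ le_top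
          induction a using WithTop.recTopCoe with
          | top => exact le_rfl
          | coe a => rcases a with i | j
                     · exact (huhi i).le
                     · exact (hvhi j).le
        | coe b =>
          induction a using WithTop.recTopCoe with
          | top =>
            refine iff_of_false ?_ (by simp)
            rcases b with i | j
            · exact (huhi i).not_ge
            · exact (hvhi j).not_ge
          | coe a =>
            rw [WithTop.coe_le_coe]
            rcases a with i | j <;> rcases b with i' | j'
            · rw [Sum.inl_le_inl_iff]; exact hu.le_iff_le
            · exact iff_of_false (huv i j') Sum.not_inl_le_inr
            · exact iff_of_false (hvu i' j) Sum.not_inr_le_inl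
            · rw [Sum.inr_le_inr_iff]; exact hv.le_iff_le
  · intro p
    induction p using WithBot.recBotCoe with
    | bot => exact Or.inl rfl
    | coe p =>
      induction p using WithTop.recTopCoe with
      | top => exact Or.inr (Or.inl rfl)
      | coe p =>
        rcases p with i | j
        · exact Or.inr (Or.inr (Or.inl ⟨i, rfl⟩))
        · exact Or.inr (Or.inr (Or.inr ⟨j, rfl⟩))

/-- The set of the elements that a permutation puts in the first `i` positions. -/
def initialSegment {k : ℕ} (π : Equiv.Perm (Fin k)) (i : ℕ) : Finset (Fin k) :=
  univ.filter fun y => (π y : ℕ) < i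

lemma mem_initialSegment {k : ℕ} {π : Equiv.Perm (Fin k)} {i : ℕ} {y : Fin k} :
    y ∈ initialSegment π i ↔ (π y : ℕ) < i := by
  simp [initialSegment]

lemma initialSegment_mono {k : ℕ} (π : Equiv.Perm (Fin k)) : Monotone (initialSegment π) :=
  fun _ _ hij _ hy => mem_initialSegment.2 ((mem_initialSegment.1 hy).trans_le hij)

lemma initialSegment_zero {k : ℕ} (π : Equiv.Perm (Fin k)) : initialSegment π 0 = ∅ := by
  simp [initialSegment]

lemma initialSegment_self {k : ℕ} (π : Equiv.Perm (Fin k)) : initialSegment π k = univ := by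
  simp [initialSegment]

lemma card_initialSegment {k : ℕ} (π : Equiv.Perm (Fin k)) {i : ℕ} (hi : i ≤ k) :
    #(initialSegment π i) = i := by
  have h : (initialSegment π i).map π.toEmbedding = univ.filter fun y : Fin k => (y : ℕ) < i := by
    ext y
    simp only [mem_map_equiv, mem_initialSegment, Equiv.apply_symm_apply, mem_filter, mem_univ,
      true_and]
  rw [← card_map, h, Fin.card_filter_val_lt, min_eq_right hi]

lemma card_initialSegment_le {k : ℕ} (π : Equiv.Perm (Fin k)) (i : ℕ) :
    #(initialSegment π i) ≤ i := by
  rcases le_total i k with h | h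
  · exact (card_initialSegment π h).le
  · exact (card_le_univ _).trans (by simpa using h)

/-- If two orderings never reverse a pair whose elements are at distance at least `m` in both
orderings, then every element has almost the same position in both. -/
lemma position_lt_of_no_reversal {k m : ℕ} {π σ : Equiv.Perm (Fin k)} (a : Fin k) (hm : 0 < m)
    (h : ∀ b, (π b : ℕ) + m ≤ π a → (σ b : ℕ) < σ a + m) : (π a : ℕ) < σ a + 2 * m := by
  by_contra! hlt
  have hsub : initialSegment π (π a + 1 - m) ⊆ initialSegment σ (σ a + m) := fun b hb =>
    mem_initialSegment.2 (h b (by have := mem_initialSegment.1 hb; omega))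
  have h1 := card_le_card hsub
  rw [card_initialSegment π (by have := (π a).isLt; omega)] at h1
  have h2 := card_initialSegment_le σ (σ a + m)
  omega

lemma card_le_of_no_reversal {k m : ℕ} (hm : 0 < m) (σ : Equiv.Perm (Fin k))
    (S : Finset (Equiv.Perm (Fin k)))
    (hS : ∀ π ∈ S, ∀ a b, (σ a : ℕ) + m ≤ σ b → ¬ (π b : ℕ) + m ≤ π a) :
    #S ≤ (4 * m) ^ k := by
  have hup : ∀ π ∈ S, ∀ a, (π a : ℕ) < σ a + 2 * m := fun π hπ a =>
    position_lt_of_no_reversal a hm fun b hb => by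
      by_contra! hlt
      exact hS π hπ a b hlt hb
  have hdown : ∀ π ∈ S, ∀ a, (σ a : ℕ) < π a + 2 * m := fun π hπ a =>
    position_lt_of_no_reversal a hm fun b hb => by
      by_contra! hlt
      exact hS π hπ b a hb hlt
  let F : Equiv.Perm (Fin k) → Fin k → ℕ := fun π a => π a + 2 * m - σ a
  calc #S ≤ #(Fintype.piFinset fun _ : Fin k => range (4 * m)) := by
        refine card_le_card_of_injOn F ?_ ?_
        · intro π hπ
          rw [mem_coe, Fintype.mem_piFinset]
          intro a
          have := hup π hπ a
          simp only [F, mem_range]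
          omega
        · intro π hπ τ hτ heq
          ext a
          have h1 := hdown π hπ a
          have h2 := hdown τ hτ a
          have h3 : (π a : ℕ) + 2 * m - σ a = τ a + 2 * m - σ a := congrFun heq a
          omega
    _ = (4 * m) ^ k := by simp

/-- Two blue chains along sufficiently different orderings, with the same bottom and the same
top, contain a blue subdivided diamond. -/
lemma exists_blue_subdividedDiamond {α : Type*} [PartialOrder α] {k s t : ℕ}
    (c : α × Finset (Fin k) → Bool) {π σ : Equiv.Perm (Fin k)} {X Z : ℕ → α}
    (hX : Monotone X) (hZ : Monotone Z)
    (hcX : ∀ i ≤ k, c (X i, initialSegment π i) = true)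
    (hcZ : ∀ i ≤ k, c (Z i, initialSegment σ i) = true)
    (h0 : X 0 = Z 0) (hk : X k = Z k) {a b : Fin k}
    (hπ : (π a : ℕ) + s ≤ π b) (hσ : (σ b : ℕ) + t ≤ σ a) :
    ∃ e : WithBot (WithTop (Fin s ⊕ Fin t)) ↪o α × Finset (Fin k), ∀ p, c (e p) = true := by
  have hak := (σ a).isLt
  have hbk := (π b).isLt
  have strict : ∀ {τ : Equiv.Perm (Fin k)} {W : ℕ → α}, Monotone W → ∀ {i j : ℕ}, i < j → j ≤ k →
      (W i, initialSegment τ i) < (W j, initialSegment τ j) := by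
    intro τ W hW i j hij hj
    refine lt_of_le_of_ne ⟨hW hij.le, initialSegment_mono τ hij.le⟩ fun h => hij.ne ?_
    have := congrArg (fun p => #p.2) h
    simpa [card_initialSegment τ hj, card_initialSegment τ (hij.le.trans hj)] using this
  have hbot : (X 0, initialSegment π 0) = (Z 0, initialSegment σ 0) := by
    rw [h0, initialSegment_zero, initialSegment_zero]
  have htop : (X k, initialSegment π k) = (Z k, initialSegment σ k) := by
    rw [hk, initialSegment_self, initialSegment_self]
  obtain ⟨e, he⟩ := exists_subdividedDiamond_embedding
    (lo := (X 0, initialSegment π 0)) (hi := (X k, initialSegment π k))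
    (u := fun p : Fin s => (X (π a + 1 + p), initialSegment π (π a + 1 + p)))
    (v := fun q : Fin t => (Z (σ b + 1 + q), initialSegment σ (σ b + 1 + q)))
    (fun p q hpq => strict hX (by have : (p : ℕ) < q := hpq; omega) (by omega))
    (fun p q hpq => strict hZ (by have : (p : ℕ) < q := hpq; omega) (by omega))
    (strict hX (by omega) le_rfl)
    (fun p => strict hX (by omega) (by omega))
    (fun q => hbot ▸ strict hZ (by omega) (by omega))
    (fun p => strict hX (by omega) le_rfl)
    (fun q => htop ▸ strict hZ (by omega) le_rfl)
    (fun p q h => by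
      have := mem_initialSegment.1 (h.2 (mem_initialSegment (y := a).2 (by omega)))
      omega)
    (fun p q h => by
      have := mem_initialSegment.1 (h.2 (mem_initialSegment (y := b).2 (by omega)))
      omega)
  refine ⟨e, fun p => ?_⟩
  rcases he p with h | h | ⟨i, h⟩ | ⟨j, h⟩ <;> rw [h]
  · exact hcX 0 (by omega)
  · exact hcX k le_rfl
  · exact hcX _ (by omega)
  · exact hcZ _ (by omega)

theorem posetRamsey_subdividedDiamond_le {n k m s t : ℕ} (hs : 0 < s) (hsm : s ≤ m) (htm : t ≤ m)
    (hk : 4 ^ n * (4 * m) ^ k < k.factorial) :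
    posetRamsey (WithBot (WithTop (Fin s ⊕ Fin t))) (Finset (Fin n)) ≤ n + k := by
  refine Nat.sInf_le fun c => ?_
  let g : Finset (Fin n) × Finset (Fin k) ↪o Finset (Fin (n + k)) :=
    (Finset.sumEquiv.symm.toOrderEmbedding).trans (mapEmbedding finSumFinEquiv.toEmbedding)
  by_cases hred : ∃ e : Finset (Fin n) ↪o Finset (Fin n) × Finset (Fin k), ∀ a, c (g (e a)) = false
  · obtain ⟨e, he⟩ := hred
    exact Or.inr ⟨e.trans g, he⟩
  left
  have hchain := fun π : Equiv.Perm (Fin k) =>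
    (exists_red_embedding_or_blue_chain (fun x => c (g x)) k _ (initialSegment_mono π)).resolve_left
      hred
  choose X hX hblue using hchain
  have hcard : Fintype.card (Finset (Fin n) × Finset (Fin n)) * (4 * m) ^ k <
      Fintype.card (Equiv.Perm (Fin k)) := by
    rw [Fintype.card_perm, Fintype.card_prod, Fintype.card_finset, Fintype.card_fin,
      Fintype.card_fin, ← mul_pow]
    exact hk
  obtain ⟨⟨A, B⟩, hAB⟩ :=
    Fintype.exists_lt_card_fiber_of_mul_lt_card (fun π => (X π 0, X π k)) hcard
  obtain ⟨σ, hσ⟩ := card_pos.1 (hAB.trans_le' (Nat.zero_le _))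
  have hrev : ¬ ∀ π ∈ (univ.filter fun π => (X π 0, X π k) = (A, B)),
      ∀ a b, (σ a : ℕ) + m ≤ σ b → ¬ (π b : ℕ) + m ≤ π a := fun h =>
    hAB.not_ge (card_le_of_no_reversal (hs.trans_le hsm) σ _ h)
  push Not at hrev
  obtain ⟨π, hπ, a, b, hab, hba⟩ := hrev
  simp only [mem_filter, mem_univ, true_and, Prod.mk.injEq] at hσ hπ
  obtain ⟨e, he⟩ := exists_blue_subdividedDiamond (s := s) (t := t) (fun x => c (g x)) (hX σ) (hX π)
    (hblue σ) (hblue π) (hσ.1.trans hπ.1.symm) (hσ.2.trans hπ.2.symm) (a := a) (b := b)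
    (by omega) (by omega)
  exact ⟨e.trans g, he⟩

open Filter Asymptotics in
lemma eventually_logb_le_mul_rpow {r C : ℝ} (hr : 0 < r) (hC : 0 < C) :
    ∀ᶠ n : ℕ in atTop, Real.logb 2 (n : ℝ) ≤ C * (n : ℝ) ^ r := by
  have h2 : 0 < Real.log 2 := Real.log_pos one_lt_two
  have h := (isLittleO_log_rpow_atTop hr).bound (mul_pos hC h2)
  filter_upwards [tendsto_natCast_atTop_atTop.eventually h] with n hn
  rw [Real.logb, div_le_iff₀ h2]
  have h0 : (0 : ℝ) ≤ (n : ℝ) ^ r := by positivity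
  rw [Real.norm_of_nonneg h0] at hn
  calc Real.log n ≤ ‖Real.log (n : ℝ)‖ := Real.le_norm_self _
    _ ≤ C * Real.log 2 * (n : ℝ) ^ r := hn
    _ = C * (n : ℝ) ^ r * Real.log 2 := by ring

lemma div_three_pow_le_factorial (k : ℕ) : ((k : ℝ) / 3) ^ k ≤ (k.factorial : ℝ) := by
  rcases Nat.eq_zero_or_pos k with rfl | hk
  · simp
  refine le_trans ?_ (Stirling.le_factorial_stirling k)
  have hk1 : (1 : ℝ) ≤ k := by exact_mod_cast hk
  have h1 : 1 ≤ √(2 * Real.pi * k) := by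
    rw [Real.one_le_sqrt]
    nlinarith [Real.pi_gt_three]
  have h2 : ((k : ℝ) / 3) ^ k ≤ (k / Real.exp 1) ^ k := by
    gcongr
    linarith [Real.exp_one_lt_d9]
  exact h2.trans (le_mul_of_one_le_left (by positivity) h1)

/-- The factorial of `⌊(2 + ε) n / log n⌋` beats `4 ^ n` by more than a factor `(4 m) ^ k` as long
as `m ≤ log n`. -/
lemma eventually_mul_pow_lt_factorial {ε : ℝ} (hε : 0 < ε) :
    ∀ᶠ n : ℕ in Filter.atTop, ∀ m : ℕ, 0 < m → (m : ℝ) ≤ Real.logb 2 n →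
      4 ^ n * (4 * m) ^ ⌊(2 + ε) * ((n : ℝ) / Real.logb 2 n)⌋₊ <
        (⌊(2 + ε) * ((n : ℝ) / Real.logb 2 n)⌋₊).factorial := by
  set δ : ℝ := ε / (2 * (2 + ε)) with hδ
  have hδ0 : 0 < δ := by positivity
  have hδ1 : δ < 1 := by
    rw [hδ, div_lt_one (by positivity)]
    linarith
  have hδε : (1 - δ) * (2 + ε) = 2 + ε / 2 := by
    rw [hδ]
    field_simp
    ring
  filter_upwards [eventually_logb_le_mul_rpow one_pos (by positivity : 0 < ε / 4),
    eventually_logb_le_mul_rpow one_pos one_pos,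
    eventually_logb_le_mul_rpow (half_pos hδ0) (by norm_num : (0 : ℝ) < 1 / 12),
    Filter.eventually_ge_atTop 2] with n hn1 hn2 hn3 hn m hm hmL
  set L := Real.logb 2 (n : ℝ) with hL
  set k := ⌊(2 + ε) * ((n : ℝ) / L)⌋₊ with hk
  rw [Real.rpow_one] at hn1 hn2
  have hn0 : (0 : ℝ) < n := by exact_mod_cast (by omega : 0 < n)
  have hm1 : (1 : ℝ) ≤ m := by exact_mod_cast hm
  have hL0 : 0 < L := by linarith
  have hnL : 1 ≤ n / L := by
    rw [le_div_iff₀ hL0]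
    linarith
  have hkgt : (2 + ε) * (n / L) - 1 < k := Nat.sub_one_lt_floor _
  have hkn : n / L ≤ k := by nlinarith
  have hpow : 12 * m * (n : ℝ) ^ (1 - δ) ≤ k := by
    refine le_trans ?_ hkn
    rw [le_div_iff₀ hL0]
    have hsq : (n : ℝ) ^ (δ / 2) * (n : ℝ) ^ (δ / 2) * (n : ℝ) ^ (1 - δ) = n := by
      rw [← Real.rpow_add hn0, ← Real.rpow_add hn0]
      ring_nf
      exact Real.rpow_one _
    have hr : 0 ≤ (n : ℝ) ^ (δ / 2) := by positivity
    calc 12 * m * (n : ℝ) ^ (1 - δ) * L = 12 * (m * L) * (n : ℝ) ^ (1 - δ) := by ring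
      _ ≤ 12 * ((1 / 12 * (n : ℝ) ^ (δ / 2)) * (1 / 12 * (n : ℝ) ^ (δ / 2))) *
          (n : ℝ) ^ (1 - δ) := by
        gcongr
        exact hmL.trans hn3
      _ = 1 / 12 * ((n : ℝ) ^ (δ / 2) * (n : ℝ) ^ (δ / 2) * (n : ℝ) ^ (1 - δ)) := by ring
      _ ≤ n := by rw [hsq]; linarith
  have hexp : 2 * (n : ℝ) < L * (1 - δ) * k := by
    have h1 : L * (1 - δ) * ((2 + ε) * (n / L) - 1) = (1 - δ) * (2 + ε) * n - (1 - δ) * L := by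
      field_simp
    have h2 : L * (1 - δ) * ((2 + ε) * (n / L) - 1) < L * (1 - δ) * k :=
      mul_lt_mul_of_pos_left hkgt (mul_pos hL0 (by linarith))
    rw [h1, hδε] at h2
    nlinarith
  have hfour : (4 : ℝ) ^ n < ((n : ℝ) ^ (1 - δ)) ^ k := by
    have h2n : (2 : ℝ) ^ L = n := Real.rpow_logb two_pos (by norm_num) hn0
    calc (4 : ℝ) ^ n = (2 : ℝ) ^ (2 * (n : ℝ)) := by
          rw [Real.rpow_mul two_pos.le, Real.rpow_natCast]
          norm_num
      _ < (2 : ℝ) ^ (L * (1 - δ) * k) := Real.rpow_lt_rpow_of_exponent_lt one_lt_two hexp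
      _ = ((n : ℝ) ^ (1 - δ)) ^ k := by
          rw [Real.rpow_mul two_pos.le, Real.rpow_mul two_pos.le, h2n, Real.rpow_natCast]
  have hreal : (4 : ℝ) ^ n * (4 * m) ^ k < (k.factorial : ℝ) :=
    calc (4 : ℝ) ^ n * (4 * m) ^ k < ((n : ℝ) ^ (1 - δ)) ^ k * (4 * m) ^ k := by gcongr
      _ = ((12 * m * (n : ℝ) ^ (1 - δ)) / 3) ^ k := by
          rw [← mul_pow]
          ring_nf
      _ ≤ ((k : ℝ) / 3) ^ k := by gcongr
      _ ≤ k.factorial := div_three_pow_le_factorial k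
  exact_mod_cast hreal

/-- Let `s, t : ℕ → ℕ` with `s n, t n ≥ 1` and `s n + t n = o(log log n)`.
Then for every `ε > 0` there is `n₀` such that for all `n ≥ n₀`,
`R(SD_{s n, t n}, Q_n) ≤ n + (2 + ε)·(n / log n)`, where the subdivided diamond
`SD_{s,t}` is two parallel chains of lengths `s` and `t` together with a new bottom and a
new top element (modelled as `WithBot (WithTop (Fin s ⊕ Fin t))`). -/
theorem subdivided_diamond_ramsey_upper (s t : ℕ → ℕ) (hs1 : ∀ n, 1 ≤ s n)
    (ht1 : ∀ n, 1 ≤ t n)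
    (hst : ∀ δ : ℝ, 0 < δ → ∃ n₁ : ℕ, ∀ n : ℕ, n₁ ≤ n →
      ((s n : ℝ) + (t n : ℝ)) ≤ δ * Real.logb 2 (Real.logb 2 (n : ℝ)))
    (ε : ℝ) (hε : 0 < ε) :
    ∃ n₀ : ℕ, ∀ n : ℕ, n₀ ≤ n →
      (posetRamsey (WithBot (WithTop (Fin (s n) ⊕ Fin (t n)))) (Finset (Fin n)) : ℝ) ≤
        (n : ℝ) + (2 + ε) * ((n : ℝ) / Real.logb 2 (n : ℝ)) := by
  obtain ⟨n₁, hn₁⟩ := hst 1 one_pos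
  obtain ⟨n₂, hn₂⟩ := Filter.eventually_atTop.1 (eventually_mul_pow_lt_factorial hε)
  refine ⟨max (max n₁ n₂) 4, fun n hn => ?_⟩
  have hn4 : (4 : ℝ) ≤ n := by exact_mod_cast (le_max_right _ _).trans hn
  have hL1 : 0 < Real.logb 2 (n : ℝ) := Real.logb_pos one_lt_two (by linarith)
  have hmL : ((s n + t n : ℕ) : ℝ) ≤ Real.logb 2 n := by
    have h := hn₁ n (by omega)
    have hlog : Real.logb 2 (Real.logb 2 (n : ℝ)) ≤ Real.logb 2 n := by
      rw [Real.logb_le_iff_le_rpow one_lt_two hL1,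
        Real.rpow_logb two_pos (by norm_num) (by linarith), Real.logb_le_iff_le_rpow one_lt_two
          (by linarith), Real.rpow_natCast]
      exact_mod_cast Nat.lt_two_pow_self.le
    push_cast
    linarith
  have hle := posetRamsey_subdividedDiamond_le (n := n) (hs1 n) (Nat.le_add_right _ (t n))
    (Nat.le_add_left _ (s n)) (hn₂ n (by omega) _ (Nat.add_pos_left (hs1 n) _) hmL)
  calc (posetRamsey (WithBot (WithTop (Fin (s n) ⊕ Fin (t n)))) (Finset (Fin n)) : ℝ)
      ≤ ((n + ⌊(2 + ε) * ((n : ℝ) / Real.logb 2 n)⌋₊ : ℕ) : ℝ) := by exact_mod_cast hle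
    _ ≤ n + (2 + ε) * ((n : ℝ) / Real.logb 2 (n : ℝ)) := by
      push_cast
      gcongr
      exact Nat.floor_le (by positivity)
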